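/- arXiv:1701.04261 — 2 statements merged into one kernel-verified Lean document; each statement's English description precedes it below -/
import Mathlib

section
/- Let k be an algebraically closed field, let d be an integer with 1 ≤ d ≤ 4, and let f be a homogeneous polynomial of degree d in 5 variables over k defining a smooth hypersurface X ⊂ P⁴_k. Then X contains a line: there exist two linearly independent vectors v, w ∈ k^5 such that f(s·v + t·w) = 0 for all s, t ∈ k. -/
open MvPolynomial

/-- The restriction of `f` to the affine line `X ↦ X • v + w`, as a univariate polynomial. -/
noncomputable def MvPolynomial.restrictLine {k σ R : Type*} [CommRing k] [CommRing R] [Algebra k R]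
    (f : MvPolynomial σ k) (v w : σ → R) : Polynomial R :=
  aeval (fun i => Polynomial.C (v i) * Polynomial.X + Polynomial.C (w i)) f

namespace MvPolynomial

section

variable {k σ R S : Type*} [CommRing k] [CommRing R] [CommRing S] [Algebra k R] [Algebra k S]

lemma map_restrictLine (φ : R →ₐ[k] S) (f : MvPolynomial σ k) (v w : σ → R) :
    (f.restrictLine v w).map (φ : R →+* S) =
      f.restrictLine (fun i => φ (v i)) (fun i => φ (w i)) := by
  have : (Polynomial.mapAlgHom φ).comp
      (aeval (fun i => Polynomial.C (v i) * Polynomial.X + Polynomial.C (w i))) =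
      aeval (fun i => Polynomial.C (φ (v i)) * Polynomial.X + Polynomial.C (φ (w i))) := by
    ext i
    simp
  exact DFunLike.congr_fun this f

lemma eval_restrictLine (f : MvPolynomial σ k) (v w : σ → R) (s : R) :
    (f.restrictLine v w).eval s = aeval (fun i => s * v i + w i) f := by
  have : ((Polynomial.aeval (R := R) s).restrictScalars k).comp
      (aeval (fun i => Polynomial.C (v i) * Polynomial.X + Polynomial.C (w i))) =
      aeval (fun i => s * v i + w i) := by
    ext i
    simp [mul_comm (v i)]
  rw [← this, ← Polynomial.coe_aeval_eq_eval]
  rfl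

lemma natDegree_restrictLine_le {d : ℕ} {f : MvPolynomial σ k}
    (hf : f.IsHomogeneous d) (v w : σ → R) : (f.restrictLine v w).natDegree ≤ d := by
  have := aeval_natDegree_le (map (algebraMap k R) f) (hf.map _).totalDegree_le
    (fun i => Polynomial.C (v i) * Polynomial.X + Polynomial.C (w i))
    (n := 1) fun i => Polynomial.natDegree_linear_le
  rw [mul_one] at this
  rwa [restrictLine, ← aeval_map_algebraMap (A := R)]

lemma aeval_mul_of_isHomogeneous {d : ℕ} {f : MvPolynomial σ k} (hf : f.IsHomogeneous d) (c : R)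
    (x : σ → R) : aeval (fun i => c * x i) f = c ^ d * aeval x f := by
  rw [aeval_def, aeval_def, eval₂_eq, eval₂_eq, Finset.mul_sum]
  refine Finset.sum_congr rfl fun m hm => ?_
  have : ∑ i ∈ m.support, m i = d := by
    rw [← hf (mem_support_iff.mp hm), Finsupp.weight_apply, Finsupp.sum]
    simp
  simp_rw [mul_pow]
  rw [Finset.prod_mul_distrib, Finset.prod_pow_eq_pow_sum, this]
  ring

end

/-- A homogeneous polynomial vanishing on an affine line vanishes on the plane it spans. -/
lemma aeval_eq_zero_of_restrictLine_eq_zero {k σ L : Type*} [CommRing k] [Field L]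
    [Infinite L] [Algebra k L] {d : ℕ} {f : MvPolynomial σ k} (hf : f.IsHomogeneous d)
    {v w : σ → L} (h : f.restrictLine v w = 0) (s t : L) :
    aeval (fun i => s * v i + t * w i) f = 0 := by
  have key (t : L) (ht : t ≠ 0) : aeval (fun i => s * v i + t * w i) f = 0 := by
    have : (fun i => s * v i + t * w i) = fun i => t * (s / t * v i + w i) := by
      ext i
      field_simp
    rw [this, aeval_mul_of_isHomogeneous hf, ← eval_restrictLine, h, Polynomial.eval_zero, mul_zero]
  have hpoly : f.restrictLine w (fun i => s * v i) = 0 := by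
    refine Polynomial.eq_zero_of_infinite_isRoot _
      ((Set.finite_singleton (0 : L)).infinite_compl.mono fun t ht => ?_)
    rw [Set.mem_ofPred_eq, Polynomial.IsRoot, eval_restrictLine, ← key t ht]
    simp [add_comm]
  simpa [eval_restrictLine, add_comm] using congrArg (Polynomial.eval t) hpoly

end MvPolynomial

/-- Normalising at a minor of maximal valuation gives a basis of the plane spanned by `v` and `w`
with coordinates in `O`. -/
lemma ValuationSubring.exists_integral_basis {L σ : Type*} [Field L] [Finite σ]
    (O : ValuationSubring L) (v w : σ → L) {a b : σ} (hab : v a * w b - v b * w a ≠ 0) :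
    ∃ (i j : σ) (α β γ δ : L),
      (∀ l, α * v l + β * w l ∈ O) ∧ (∀ l, γ * v l + δ * w l ∈ O) ∧
      α * v i + β * w i = 1 ∧ α * v j + β * w j = 0 ∧
      γ * v i + δ * w i = 0 ∧ γ * v j + δ * w j = 1 := by
  let p : σ × σ → L := fun q => v q.1 * w q.2 - v q.2 * w q.1
  have : Nonempty (σ × σ) := ⟨(a, b)⟩
  obtain ⟨⟨i, j⟩, hmax⟩ := Finite.exists_max fun q => O.valuation (p q)
  have hp : p (i, j) ≠ 0 := by
    intro h0
    have h1 := hmax (a, b)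
    simp only [h0, map_zero, le_zero_iff, map_eq_zero] at h1
    exact hab h1
  have hmem (q : σ × σ) : p q / p (i, j) ∈ O := by
    rw [← O.valuation_le_one_iff, map_div₀]
    exact div_le_one_of_le₀ (hmax q) zero_le
  refine ⟨i, j, w j / p (i, j), - v j / p (i, j), - w i / p (i, j), v i / p (i, j),
    fun l => ?_, fun l => ?_, ?_, ?_, ?_, ?_⟩
  · convert hmem (l, j) using 1
    simp only [p]; ring
  · convert hmem (i, l) using 1
    simp only [p]; ring
  all_goals
    field_simp
    simp only [p]; ring

/-- A nonunit of a finitely generated algebra over an algebraically closed field `k` vanishes at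
some `k`-point. -/
lemma exists_algHom_apply_eq_zero {k A : Type*} [Field k] [IsAlgClosed k] [CommRing A] [Algebra k A]
    [Algebra.FiniteType k A] {a : A} (ha : ¬ IsUnit a) : ∃ φ : A →ₐ[k] k, φ a = 0 := by
  obtain ⟨m, hm, ham⟩ := exists_max_ideal_of_mem_nonunits ha
  let : Field (A ⧸ m) := Ideal.Quotient.field m
  have := finite_of_finite_type_of_isJacobsonRing k (A ⧸ m)
  let ψ : (A ⧸ m) →ₐ[k] k := IsAlgClosed.lift
  exact ⟨ψ.comp (Ideal.Quotient.mkₐ k m), by simp [Ideal.Quotient.eq_zero_iff_mem.mpr ham]⟩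

/-- A transcendental element lies in the maximal ideal of some valuation ring over `k`. -/
lemma Transcendental.exists_valuationSubring {k L : Type*} [Field k] [Field L] [Algebra k L] {x : L}
    (hx : Transcendental k x) :
    ∃ O : ValuationSubring L, (∀ c : k, algebraMap k L c ∈ O) ∧ x ∈ O.nonunits := by
  let A : Subalgebra k L := (Polynomial.aeval (R := k) x).range
  let y : A.toSubring := ⟨x, Polynomial.X, by simp⟩
  have hI : Ideal.span {y} ≠ ⊤ := by
    rw [Ne, Ideal.span_singleton_eq_top, isUnit_iff_exists_inv]
    rintro ⟨⟨_, p, rfl⟩, hp⟩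
    have h1 : Polynomial.aeval x (Polynomial.X * p) = Polynomial.aeval x (1 : Polynomial k) := by
      simpa [y] using congrArg Subtype.val hp
    have h2 := transcendental_iff_injective.mp hx h1
    exact Polynomial.not_isUnit_X (IsUnit.of_mul_eq_one _ h2)
  obtain ⟨O, hO, hyO⟩ := Ideal.image_subset_nonunits_valuationSubring _ hI
  exact ⟨O, fun c => hO (A.algebraMap_mem c), hyO ⟨y, Ideal.subset_span rfl, rfl⟩⟩

lemma MvPolynomial.dvd_aeval_sub_aeval {k ι R : Type*} [CommRing k] [CommRing R] [Algebra k R]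
    {a : R} {x y : ι → R} (h : ∀ i, a ∣ x i - y i) (p : MvPolynomial ι k) :
    a ∣ aeval x p - aeval y p := by
  have key : (Ideal.Quotient.mkₐ k (Ideal.span {a})).comp (aeval x) =
      (Ideal.Quotient.mkₐ k (Ideal.span {a})).comp (aeval y) := by
    ext i
    simpa [Ideal.Quotient.eq, Ideal.mem_span_singleton] using h i
  rw [← Ideal.mem_span_singleton, ← Ideal.Quotient.eq]
  exact DFunLike.congr_fun key p

/-- The system `y j + X * G j y = 0` has a solution in power series. -/
lemma exists_powerSeries_forall_add_X_mul_aeval_eq_zero {k ι : Type*} [CommRing k]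
    (G : ι → MvPolynomial ι k) :
    ∃ y : ι → PowerSeries k, ∀ j, y j + PowerSeries.X * aeval y (G j) = 0 := by
  let z : ℕ → ι → PowerSeries k := fun n =>
    (fun y j => -(PowerSeries.X * aeval y (G j)))^[n] 0
  have hz (n : ℕ) (j : ι) : z (n + 1) j = -(PowerSeries.X * aeval (z n) (G j)) := by
    simp only [z, Function.iterate_succ_apply']
  have hstep (n : ℕ) : ∀ j, (PowerSeries.X : PowerSeries k) ^ n ∣ z (n + 1) j - z n j := by
    induction n with
    | zero => simp
    | succ n ih =>
      intro j
      rw [hz (n + 1), hz n, pow_succ', neg_sub_neg, ← mul_sub, ← dvd_neg, ← mul_neg, neg_sub]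
      exact mul_dvd_mul_left _ (MvPolynomial.dvd_aeval_sub_aeval ih _)
  have hle {n m : ℕ} (hnm : n ≤ m) (j : ι) :
      (PowerSeries.X : PowerSeries k) ^ n ∣ z m j - z n j := by
    induction m, hnm using Nat.le_induction with
    | base => simp
    | succ m hm ih =>
      rw [← sub_add_sub_cancel _ (z m j)]
      exact dvd_add ((pow_dvd_pow _ hm).trans (hstep m j)) ih
  let y : ι → PowerSeries k := fun j => PowerSeries.mk fun n => PowerSeries.coeff n (z (n + 1) j)
  have hy (n : ℕ) (j : ι) : (PowerSeries.X : PowerSeries k) ^ n ∣ y j - z n j := by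
    rw [PowerSeries.X_pow_dvd_iff]
    intro i hi
    have := PowerSeries.X_pow_dvd_iff.mp (hle (Nat.succ_le_of_lt hi) j) i (Nat.lt_succ_self i)
    rw [map_sub, sub_eq_zero] at this ⊢
    rw [this, PowerSeries.coeff_mk]
  refine ⟨y, fun j => ?_⟩
  ext n
  have h : (PowerSeries.X : PowerSeries k) ^ (n + 1) ∣ y j + PowerSeries.X * aeval y (G j) := by
    have h1 : y j + PowerSeries.X * aeval y (G j) =
        (y j - z (n + 2) j) + PowerSeries.X * (aeval y (G j) - aeval (z (n + 1)) (G j)) := by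
      rw [hz]; ring
    rw [h1]
    exact dvd_add ((pow_dvd_pow _ (Nat.le_succ _)).trans (hy (n + 2) j))
      (dvd_mul_of_dvd_right (MvPolynomial.dvd_aeval_sub_aeval (hy (n + 1)) _) _)
  simpa using PowerSeries.X_pow_dvd_iff.mp h n (Nat.lt_succ_self n)

/-- If a member `x • f₀ + f` of a pencil with transcendental parameter contains a line,
then so does `f`. -/
lemma MvPolynomial.exists_restrictLine_eq_zero_of_transcendental {k L ι : Type*} [Field k]
    [IsAlgClosed k] [Field L] [Algebra k L] [Finite ι] {d : ℕ} {f₀ f : MvPolynomial ι k}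
    (hf₀ : f₀.IsHomogeneous d) (hf : f.IsHomogeneous d) {x : L} (hx : Transcendental k x)
    {v w : ι → L} {a b : ι} (hab : v a * w b - v b * w a ≠ 0)
    (h : Polynomial.C x * f₀.restrictLine v w + f.restrictLine v w = 0) :
    ∃ (v' w' : ι → k) (i j : ι), v' i = 1 ∧ v' j = 0 ∧ w' i = 0 ∧ w' j = 1 ∧
      f.restrictLine v' w' = 0 := by
  have : Infinite L := Infinite.of_injective _ (algebraMap k L).injective
  let g : MvPolynomial ι L := C x * map (algebraMap k L) f₀ + map (algebraMap k L) f
  have hg : g.IsHomogeneous d := by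
    refine IsHomogeneous.add ?_ (hf.map _)
    simpa using (isHomogeneous_C ι x).mul (hf₀.map (algebraMap k L))
  have hgr (v w : ι → L) : g.restrictLine v w =
      Polynomial.C x * f₀.restrictLine v w + f.restrictLine v w := by
    simp only [restrictLine, g, map_add, map_mul, aeval_map_algebraMap, aeval_C]
    rfl
  obtain ⟨O, hkO, hxO⟩ := hx.exists_valuationSubring
  obtain ⟨i, j, α, β, γ, δ, hv, hw, hvi, hvj, hwi, hwj⟩ := O.exists_integral_basis v w hab
  set v₁ : ι → L := fun l => α * v l + β * w l with hv₁
  set w₁ : ι → L := fun l => γ * v l + δ * w l with hw₁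
  have hg₁ : g.restrictLine v₁ w₁ = 0 := by
    refine Polynomial.funext fun s => ?_
    rw [eval_restrictLine, Polynomial.eval_zero, ← aeval_eq_zero_of_restrictLine_eq_zero hg
      ((hgr v w).trans h) (s * α + γ) (s * β + δ)]
    congr 2
    ext l
    simp only [v₁, w₁]
    ring
  let S : Set L := insert x (Set.range v₁ ∪ Set.range w₁)
  let A : Subalgebra k L := Algebra.adjoin k S
  have : Algebra.FiniteType k A := .adjoin_of_finite
    (((Set.finite_range v₁).union (Set.finite_range w₁)).insert x)
  have hAO : ∀ y ∈ A, y ∈ O := by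
    let B : Subalgebra k L := { O.toSubring with algebraMap_mem' := hkO }
    have hSB : S ⊆ B := by
      rintro _ (rfl | ⟨l, rfl⟩ | ⟨l, rfl⟩)
      · exact O.nonunits_subset hxO
      · exact hv l
      · exact hw l
    exact fun y hy => Algebra.adjoin_le hSB hy
  let x' : A := ⟨x, Algebra.subset_adjoin (Set.mem_insert _ _)⟩
  have hx' : ¬ IsUnit x' := by
    rw [isUnit_iff_exists_inv]
    rintro ⟨⟨y, hy⟩, hxy⟩
    have h1 : x * y = 1 := congrArg Subtype.val hxy
    have h2 : O.valuation x * O.valuation y < 1 :=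
      mul_lt_one_of_lt_of_le (O.mem_nonunits_iff.mp hxO) ((O.valuation_le_one_iff y).mpr (hAO y hy))
    rw [← map_mul, h1, map_one] at h2
    exact lt_irrefl _ h2
  obtain ⟨φ, hφ⟩ := exists_algHom_apply_eq_zero (k := k) hx'
  let v₂ : ι → A := fun l => ⟨v₁ l, Algebra.subset_adjoin (.inr (.inl ⟨l, rfl⟩))⟩
  let w₂ : ι → A := fun l => ⟨w₁ l, Algebra.subset_adjoin (.inr (.inr ⟨l, rfl⟩))⟩
  have h₂ : Polynomial.C x' * f₀.restrictLine v₂ w₂ + f.restrictLine v₂ w₂ = 0 := by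
    refine Polynomial.map_injective (A.val : A →+* L) Subtype.val_injective ?_
    rw [Polynomial.map_add, Polynomial.map_mul, map_restrictLine, map_restrictLine,
      Polynomial.map_C, Polynomial.map_zero, ← hg₁, hgr]
    rfl
  have h₃ := congrArg (Polynomial.map (φ : A →+* k)) h₂
  rw [Polynomial.map_add, Polynomial.map_mul, map_restrictLine, map_restrictLine,
    Polynomial.map_C, Polynomial.map_zero, RingHom.coe_coe, hφ, map_zero, zero_mul, zero_add] at h₃
  have hv₂i : v₂ i = 1 := Subtype.ext hvi
  have hv₂j : v₂ j = 0 := Subtype.ext hvj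
  have hw₂i : w₂ i = 0 := Subtype.ext hwi
  have hw₂j : w₂ j = 1 := Subtype.ext hwj
  exact ⟨fun l => φ (v₂ l), fun l => φ (w₂ l), i, j, by simp [hv₂i], by simp [hv₂j],
    by simp [hw₂i], by simp [hw₂j], h₃⟩

/-- A hypersurface of degree `d ≤ 4` and a chart of the Grassmannian of lines in which its
equations for containing a line are `d + 1` coordinates. -/
lemma exists_restrictLine_eq_sum (k : Type*) [CommRing k] {d : ℕ} (hd1 : 1 ≤ d) (hd4 : d ≤ 4) :
    ∃ (f₀ : MvPolynomial (Fin 5) k) (v w : Fin 5 → MvPolynomial (Fin (d + 1)) k),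
      f₀.IsHomogeneous d ∧ v 0 = 1 ∧ v 1 = 0 ∧ w 0 = 0 ∧ w 1 = 1 ∧
      f₀.restrictLine v w = ∑ j : Fin (d + 1), Polynomial.C (X j) * Polynomial.X ^ (j : ℕ) := by
  have hX (i : Fin 5) : (X i : MvPolynomial (Fin 5) k).IsHomogeneous 1 := isHomogeneous_X k i
  interval_cases d
  · refine ⟨X 2, ![1, 0, X 1, 0, 0], ![0, 1, X 0, 0, 0], hX 2, rfl, rfl, rfl, rfl, ?_⟩
    simp [restrictLine, Fin.sum_univ_succ]
    ring
  · refine ⟨X 2 * X 0 + X 3 * X 1, ![1, 0, X 2, 0, 0], ![0, 1, X 1, X 0, 0],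
      ((hX 2).mul (hX 0)).add ((hX 3).mul (hX 1)), rfl, rfl, rfl, rfl, ?_⟩
    simp [restrictLine, Fin.sum_univ_succ]
    ring
  · refine ⟨X 2 * X 0 ^ 2 + X 3 * X 1 ^ 2, ![1, 0, X 3, X 1, 0], ![0, 1, X 2, X 0, 0],
      ((hX 2).mul ((hX 0).pow 2)).add ((hX 3).mul ((hX 1).pow 2)), rfl, rfl, rfl, rfl, ?_⟩
    simp [restrictLine, Fin.sum_univ_succ]
    ring
  · refine ⟨X 2 * X 0 ^ 3 + X 3 * X 1 ^ 3 + X 4 * (X 0 ^ 2 * X 1), ![1, 0, X 4, X 1, 0],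
      ![0, 1, X 3, X 0, X 2],
      (((hX 2).mul ((hX 0).pow 3)).add ((hX 3).mul ((hX 1).pow 3))).add
        ((hX 4).mul (((hX 0).pow 2).mul (hX 1))), rfl, rfl, rfl, rfl, ?_⟩
    simp [restrictLine, Fin.sum_univ_succ]
    ring

/-- Let `k` be an algebraically closed field, `1 ≤ d ≤ 4`, and `f` a homogeneous
polynomial of degree `d` in 5 variables over `k` defining a smooth hypersurface
`X ⊂ P⁴_k`. Then `X` contains a line. -/
theorem smooth_hypersurface_P4_contains_line
    (k : Type) [Field k] [IsAlgClosed k] (d : ℕ) (hd1 : 1 ≤ d) (hd4 : d ≤ 4)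
    (f : MvPolynomial (Fin 5) k) (hf : f.IsHomogeneous d)
    (hsmooth : ¬ ∃ x : Fin 5 → k, x ≠ 0 ∧
      MvPolynomial.eval x f = 0 ∧
      ∀ i, MvPolynomial.eval x (MvPolynomial.pderiv i f) = 0) :
    ∃ v w : Fin 5 → k, LinearIndependent k ![v, w] ∧
      ∀ s t : k, MvPolynomial.eval (fun i => s * v i + t * w i) f = 0 := by
  obtain ⟨f₀, v, w, hf₀, hv0, hv1, hw0, hw1, hsum⟩ := exists_restrictLine_eq_sum k hd1 hd4
  obtain ⟨y, hy⟩ := exists_powerSeries_forall_add_X_mul_aeval_eq_zero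
    fun j : Fin (d + 1) => (f.restrictLine v w).coeff j
  let L := FractionRing (PowerSeries k)
  let τ : L := algebraMap (PowerSeries k) L PowerSeries.X
  let ψ : PowerSeries k →ₐ[k] L := IsScalarTower.toAlgHom k (PowerSeries k) L
  let e : MvPolynomial (Fin (d + 1)) k →ₐ[k] L := ψ.comp (aeval y)
  have hinj : Function.Injective (algebraMap (PowerSeries k) L) := IsFractionRing.injective _ _
  have hτ : Transcendental k τ := by
    have hX : Transcendental k (PowerSeries.X : PowerSeries k) := by
      rw [transcendental_iff_injective]
      have : Polynomial.aeval PowerSeries.X = Polynomial.coeToPowerSeries.algHom (R := k) k := by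
        ext
        simp
      rw [this]
      convert Polynomial.coe_injective k using 1
      ext p : 1
      simp
    exact (transcendental_algebraMap_iff hinj).mpr hX
  have hτ0 : τ ≠ 0 := fun h => hτ (h ▸ isAlgebraic_zero)
  have hF : f₀.restrictLine (fun i => e (v i)) (fun i => e (w i)) +
      Polynomial.C τ * f.restrictLine (fun i => e (v i)) (fun i => e (w i)) = 0 := by
    rw [← map_restrictLine, ← map_restrictLine, hsum,
      (f.restrictLine v w).as_sum_range_C_mul_X_pow' (n := d + 1)
        (Nat.lt_succ_of_le (natDegree_restrictLine_le hf v w)),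
      ← Fin.sum_univ_eq_sum_range (fun j => Polynomial.C ((f.restrictLine v w).coeff j) *
        Polynomial.X ^ j), Polynomial.map_sum, Polynomial.map_sum, Finset.mul_sum,
      ← Finset.sum_add_distrib]
    refine Finset.sum_eq_zero fun j _ => ?_
    have := congrArg (algebraMap (PowerSeries k) L) (hy j)
    have h1 : e (X j) + τ * e ((f.restrictLine v w).coeff j) = 0 := by
      simpa [e, ψ, τ] using this
    simp only [Polynomial.map_mul, Polynomial.map_C, Polynomial.map_pow, Polynomial.map_X,
      RingHom.coe_coe]
    rw [← mul_assoc, ← add_mul, ← map_mul, ← map_add, h1, map_zero, zero_mul]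
  obtain ⟨v', w', i, j, hvi, hvj, hwi, hwj, h'⟩ :=
    exists_restrictLine_eq_zero_of_transcendental hf₀ hf (x := τ⁻¹)
      (fun h => hτ (IsAlgebraic.inv_iff.mp h)) (v := fun i => e (v i)) (w := fun i => e (w i))
      (a := 0) (b := 1) (by simp [hv0, hv1, hw0, hw1]) (by
        have := congrArg (Polynomial.C τ⁻¹ * ·) hF
        simpa [mul_add, ← mul_assoc, ← map_mul, hτ0] using this)
  have : Infinite k := IsAlgClosed.instInfinite
  refine ⟨v', w', ?_, fun s t => ?_⟩
  · rw [LinearIndependent.pair_iff]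
    intro s t hst
    have hi := congrFun hst i
    have hj := congrFun hst j
    simp [hvi, hwi] at hi
    simp [hvj, hwj] at hj
    exact ⟨hi, hj⟩
  · rw [← coe_aeval_eq_eval]
    exact aeval_eq_zero_of_restrictLine_eq_zero hf h' s t
end

section
/- Let p be a prime, let M be a finitely generated module over the ring ℤ_p of p-adic integers, and let G be a group acting on M by ℤ_p-linear automorphisms. Let M^f ⊆ M denote the submodule of elements whose stabilizer in G has finite index. Then the quotient M/M^f is torsion-free: for every m ∈ M and every integer k ≥ 0, if p^k · m ∈ M^f then m ∈ M^f. -/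
/-- The `p ^ k`-torsion of a finitely generated `ℤ_[p]`-module is finite. -/
theorem PadicInt.finite_torsionBy_pow (p : ℕ) [Fact p.Prime] (M : Type*) [AddCommGroup M]
    [Module ℤ_[p] M] [Module.Finite ℤ_[p] M] (k : ℕ) :
    Finite (Submodule.torsionBy ℤ_[p] M ((p : ℤ_[p]) ^ k)) := by
  let I : Ideal ℤ_[p] := Ideal.span {(p : ℤ_[p]) ^ k}
  have : Finite (ℤ_[p] ⧸ I) := by
    have : NeZero (p ^ k) := ⟨pow_ne_zero _ (Fact.out : p.Prime).ne_zero⟩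
    have hI : RingHom.ker (PadicInt.toZModPow (p := p) k) = I := PadicInt.ker_toZModPow k
    rw [← hI]
    exact Finite.of_injective _ (RingHom.kerLift_injective (PadicInt.toZModPow (p := p) k))
  have : Module.Finite (ℤ_[p] ⧸ I) (Submodule.torsionBy ℤ_[p] M ((p : ℤ_[p]) ^ k)) :=
    Module.Finite.of_restrictScalars_finite ℤ_[p] _ _
  exact Module.finite_of_finite (ℤ_[p] ⧸ I)

/-- The fibres of multiplication by `a` are finite if its kernel is. -/
theorem Submodule.finite_smul_fiber {R M : Type*} [CommRing R] [AddCommGroup M] [Module R M]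
    (a : R) [Finite (torsionBy R M a)] (y : M) : {x : M | a • x = y}.Finite := by
  rcases Set.eq_empty_or_nonempty {x : M | a • x = y} with h | ⟨x₀, rfl⟩
  · simp [h]
  · refine ((Set.toFinite (torsionBy R M a : Set M)).image (x₀ + ·)).subset fun x hx => ?_
    refine ⟨x - x₀, ?_, add_sub_cancel x₀ x⟩
    simpa [smul_sub, sub_eq_zero] using hx

theorem MulAction.finiteIndex_stabilizer_iff {G X : Type*} [Group G] [MulAction G X] (x : X) :
    (stabilizer G x).FiniteIndex ↔ (orbit G x).Finite := by
  rw [Subgroup.finiteIndex_iff_finite_quotient, ← Set.finite_coe_iff]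
  exact (orbitEquivQuotientStabilizer G x).finite_iff.symm


/-- Let `p` be a prime, `M` a finitely generated `ℤ_p`-module, and `G` a group acting
on `M` by `ℤ_p`-linear automorphisms. Let `M^f ⊆ M` be the submodule of elements whose
stabilizer has finite index in `G`. Then `M/M^f` is torsion-free: if `p^k • m ∈ M^f`
then `m ∈ M^f`. -/
theorem quotient_by_finite_stabilizer_submodule_torsionFree
    (p : ℕ) [Fact p.Prime] (M : Type) [AddCommGroup M] [Module ℤ_[p] M]
    [Module.Finite ℤ_[p] M] (G : Type) [Group G] [DistribMulAction G M]
    [SMulCommClass G ℤ_[p] M]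
    (m : M) (k : ℕ)
    (h : (MulAction.stabilizer G (((p : ℤ_[p]) ^ k) • m)).FiniteIndex) :
    (MulAction.stabilizer G m).FiniteIndex := by
  rw [MulAction.finiteIndex_stabilizer_iff] at h ⊢
  have := PadicInt.finite_torsionBy_pow p M k
  refine (h.preimage' (f := fun x => (p : ℤ_[p]) ^ k • x) fun y _ =>
    Submodule.finite_smul_fiber _ y).subset ?_
  rintro _ ⟨g, rfl⟩
  exact ⟨g, smul_comm g _ m⟩
end
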